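/- Fix n ≥ 2. For a nonempty set A ⊂ ℝ with at most n elements, define s_A(x) = |A ∩ (−∞, x)| for x ∈ ℝ, and define r(A) = { x − δ_n(A)·s_A(x) : x ∈ A }. Then r is a retraction of ℝ(n) onto ℝ(n−1) that is (4n−3)-Lipschitz with respect to the Hausdorff metric. Moreover Δ(r(A), A) ≤ (n−1)·δ_n(A) for all A ∈ ℝ(n). -/

import Mathlib

/-- The minimum separation function `δ_n` on finite subsets of `ℝ`:
`δ_n(A) = 0` if `|A| ≠ n`, and `δ_n(A)` is the minimal distance between
two distinct points of `A` if `|A| = n`. -/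
noncomputable def minSep (n : ℕ) (A : Finset ℝ) : ℝ :=
  if A.card = n then sInf {d : ℝ | ∃ a ∈ A, ∃ b ∈ A, a ≠ b ∧ d = dist a b} else 0

/-- `s_A(x) = |A ∩ (-∞, x)|`, the number of points of `A` below `x`. -/
noncomputable def countBelow (A : Finset ℝ) (x : ℝ) : ℕ :=
  (A.filter fun y => y < x).card

/-- The retraction `r(A) = { x - δ_n(A) s_A(x) : x ∈ A }` of `ℝ(n)` onto `ℝ(n-1)`. -/
noncomputable def lineRetract (n : ℕ) (A : Finset ℝ) : Finset ℝ :=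
  A.image fun x => x - minSep n A * (countBelow A x : ℝ)

theorem minSep_nonneg (n : ℕ) (A : Finset ℝ) : 0 ≤ minSep n A := by
  unfold minSep
  split_ifs
  · refine Real.sInf_nonneg ?_
    rintro d ⟨a, -, b, -, -, rfl⟩
    exact dist_nonneg
  · exact le_rfl

theorem minSep_of_card_ne {n : ℕ} {A : Finset ℝ} (hA : A.card ≠ n) : minSep n A = 0 :=
  if_neg hA

theorem minSep_le_dist (n : ℕ) {A : Finset ℝ} {a b : ℝ} (ha : a ∈ A) (hb : b ∈ A)
    (hab : a ≠ b) : minSep n A ≤ dist a b := by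
  unfold minSep
  split_ifs
  · refine csInf_le ⟨0, ?_⟩ ⟨a, ha, b, hb, hab, rfl⟩
    rintro d ⟨a, -, b, -, -, rfl⟩
    exact dist_nonneg
  · exact dist_nonneg

/-- The minimum separation of a set with `n ≥ 2` points is attained. -/
theorem exists_dist_eq_minSep {n : ℕ} (hn : 2 ≤ n) {A : Finset ℝ} (hA : A.card = n) :
    ∃ a ∈ A, ∃ b ∈ A, a < b ∧ b - a = minSep n A := by
  have hfin : {d : ℝ | ∃ a ∈ A, ∃ b ∈ A, a ≠ b ∧ d = dist a b}.Finite := by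
    refine ((A ×ˢ A).image fun p => dist p.1 p.2).finite_toSet.subset ?_
    rintro d ⟨a, ha, b, hb, -, rfl⟩
    simp only [Finset.coe_image, Set.mem_image, Finset.mem_coe, Finset.mem_product]
    exact ⟨(a, b), ⟨ha, hb⟩, rfl⟩
  obtain ⟨x, hx, y, hy, hxy⟩ := Finset.one_lt_card.1 (by omega : 1 < A.card)
  have hne : {d : ℝ | ∃ a ∈ A, ∃ b ∈ A, a ≠ b ∧ d = dist a b}.Nonempty :=
    ⟨_, x, hx, y, hy, hxy, rfl⟩
  obtain ⟨a, ha, b, hb, hab, h⟩ := hne.csInf_mem hfin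
  have hm : minSep n A = dist a b := by rw [minSep, if_pos hA, h]
  rcases lt_or_gt_of_ne hab with hlt | hlt
  · refine ⟨a, ha, b, hb, hlt, ?_⟩
    rw [hm, dist_comm, Real.dist_eq, abs_of_pos (sub_pos.2 hlt)]
  · refine ⟨b, hb, a, ha, hlt, ?_⟩
    rw [hm, Real.dist_eq, abs_of_pos (sub_pos.2 hlt)]

theorem countBelow_lt_card {A : Finset ℝ} {x : ℝ} (hx : x ∈ A) : countBelow A x < A.card :=
  Finset.card_lt_card <| (Finset.filter_ssubset).2 ⟨x, hx, lt_irrefl x⟩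

theorem countBelow_le_sub_one {n : ℕ} {A : Finset ℝ} (hA : A.card ≤ n) {x : ℝ} (hx : x ∈ A) :
    (countBelow A x : ℝ) ≤ n - 1 := by
  have h : countBelow A x + 1 ≤ n := (countBelow_lt_card hx).trans_le hA
  have : (countBelow A x : ℝ) + 1 ≤ n := by exact_mod_cast h
  linarith

theorem countBelow_image_of_strictMonoOn {A : Finset ℝ} {f : ℝ → ℝ}
    (hf : StrictMonoOn f (A : Set ℝ)) {x : ℝ} (hx : x ∈ A) :
    countBelow (A.image f) (f x) = countBelow A x := by
  unfold countBelow
  rw [Finset.filter_image, Finset.card_image_of_injOn]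
  · congr 1
    exact Finset.filter_congr fun y hy => hf.lt_iff_lt hy hx
  · exact hf.injOn.mono (Finset.coe_subset.2 (Finset.filter_subset _ _))

theorem lineRetract_of_card_lt {n : ℕ} {A : Finset ℝ} (hA : A.card < n) :
    lineRetract n A = A := by
  simp [lineRetract, minSep_of_card_ne hA.ne]

theorem card_lineRetract_lt {n : ℕ} (hn : 2 ≤ n) {A : Finset ℝ} (hA : A.card ≤ n) :
    (lineRetract n A).card < n := by
  rcases hA.lt_or_eq with h | h
  · rwa [lineRetract_of_card_lt h]
  obtain ⟨a, ha, b, hb, hab, hd⟩ := exists_dist_eq_minSep hn h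
  have hfilter : A.filter (· < b) = insert a (A.filter (· < a)) := by
    ext z
    simp only [Finset.mem_filter, Finset.mem_insert]
    constructor
    · rintro ⟨hz, hzb⟩
      rcases lt_trichotomy z a with hza | hza | hza
      · exact Or.inr ⟨hz, hza⟩
      · exact Or.inl hza
      · have := minSep_le_dist n hz ha hza.ne'
        rw [Real.dist_eq, abs_of_pos (sub_pos.2 hza)] at this
        linarith
    · rintro (rfl | ⟨hz, hza⟩)
      · exact ⟨ha, hab⟩
      · exact ⟨hz, hza.trans hab⟩
  have hcount : countBelow A b = countBelow A a + 1 := by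
    rw [countBelow, hfilter, Finset.card_insert_of_notMem (by simp), countBelow]
  refine lt_of_le_of_ne (Finset.card_image_le.trans hA) fun hcard => ?_
  have hinj := Finset.card_image_iff.1 (hcard.trans h.symm)
  refine hab.ne (hinj ha hb ?_)
  simp only [hcount, Nat.cast_add, Nat.cast_one]
  linarith

theorem dist_lineRetract_point_le {n : ℕ} {A : Finset ℝ} (hA : A.card ≤ n) {x : ℝ}
    (hx : x ∈ A) :
    dist (x - minSep n A * (countBelow A x : ℝ)) x ≤ ((n : ℝ) - 1) * minSep n A := by
  rw [dist_self_sub_left, Real.norm_of_nonneg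
    (mul_nonneg (minSep_nonneg n A) (Nat.cast_nonneg _)), mul_comm]
  exact mul_le_mul_of_nonneg_right (countBelow_le_sub_one hA hx) (minSep_nonneg n A)

theorem hausdorffDist_lineRetract_self_le {n : ℕ} (hn : 2 ≤ n) {A : Finset ℝ}
    (hA : A.card ≤ n) :
    Metric.hausdorffDist (lineRetract n A : Set ℝ) (A : Set ℝ) ≤
      ((n : ℝ) - 1) * minSep n A := by
  have hn' : (2 : ℝ) ≤ n := by exact_mod_cast hn
  refine Metric.hausdorffDist_le_of_mem_dist
    (mul_nonneg (by linarith) (minSep_nonneg n A)) ?_ ?_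
  · intro y hy
    obtain ⟨x, hx, rfl⟩ := Finset.mem_image.1 hy
    exact ⟨x, hx, dist_lineRetract_point_le hA hx⟩
  · intro x hx
    refine ⟨_, Finset.mem_image_of_mem _ hx, ?_⟩
    rw [dist_comm]
    exact dist_lineRetract_point_le hA hx

theorem hausdorffEDist_finset_ne_top {A B : Finset ℝ} (hA : A.Nonempty) (hB : B.Nonempty) :
    Metric.hausdorffEDist (A : Set ℝ) (B : Set ℝ) ≠ ⊤ :=
  Metric.hausdorffEDist_ne_top_of_nonempty_of_bounded hA hB
    A.finite_toSet.isBounded B.finite_toSet.isBounded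

theorem exists_dist_le_hausdorffDist {A B : Finset ℝ} (hB : B.Nonempty) {a : ℝ} (ha : a ∈ A) :
    ∃ b ∈ B, dist a b ≤ Metric.hausdorffDist (A : Set ℝ) (B : Set ℝ) := by
  obtain ⟨b, hb, h⟩ := B.finite_toSet.isCompact.exists_infDist_eq_dist hB a
  refine ⟨b, hb, h ▸ ?_⟩
  exact Metric.infDist_le_hausdorffDist_of_mem ha (hausdorffEDist_finset_ne_top ⟨a, ha⟩ hB)

/-- When the Hausdorff distance is less than half the minimum separation of `A`, nearest points
give an order isomorphism from `A` onto `B`. -/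
theorem exists_strictMonoOn_image_eq {n : ℕ} {A B : Finset ℝ} (hB : B.Nonempty)
    (hBn : B.card ≤ n)
    (h : 2 * Metric.hausdorffDist (A : Set ℝ) (B : Set ℝ) < minSep n A) :
    ∃ f : ℝ → ℝ, StrictMonoOn f (A : Set ℝ) ∧ A.image f = B ∧
      ∀ a ∈ A, dist a (f a) ≤ Metric.hausdorffDist (A : Set ℝ) (B : Set ℝ) := by
  have hcard : A.card = n := by
    by_contra hne
    rw [minSep_of_card_ne hne] at h
    linarith [Metric.hausdorffDist_nonneg (s := (A : Set ℝ)) (t := (B : Set ℝ))]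
  have hex : ∀ a : ℝ, ∃ b : ℝ, a ∈ A →
      b ∈ B ∧ dist a b ≤ Metric.hausdorffDist (A : Set ℝ) (B : Set ℝ) := fun a => by
    by_cases ha : a ∈ A
    · obtain ⟨b, hb⟩ := exists_dist_le_hausdorffDist hB ha
      exact ⟨b, fun _ => hb⟩
    · exact ⟨a, fun h => absurd h ha⟩
  choose f hf using hex
  have hmono : StrictMonoOn f (A : Set ℝ) := fun x hx y hy hxy => by
    have hsep := minSep_le_dist n hy hx hxy.ne'
    rw [Real.dist_eq, abs_of_pos (sub_pos.2 hxy)] at hsep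
    have h₁ := abs_le.1 (hf x hx).2
    have h₂ := abs_le.1 (hf y hy).2
    linarith [h₁.1, h₂.2]
  refine ⟨f, hmono, Finset.eq_of_subset_of_card_le ?_ ?_, fun a ha => (hf a ha).2⟩
  · exact Finset.image_subset_iff.2 fun a ha => (hf a ha).1
  · rw [Finset.card_image_of_injOn hmono.injOn, hcard]
    exact hBn

theorem hausdorffDist_lineRetract_le_of_lt_minSep {n : ℕ} (hn : 2 ≤ n) {A B : Finset ℝ}
    (hB : B.Nonempty) (hAn : A.card ≤ n) (hBn : B.card ≤ n)
    (h : 2 * Metric.hausdorffDist (A : Set ℝ) (B : Set ℝ) < minSep n A) :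
    Metric.hausdorffDist (lineRetract n A : Set ℝ) (lineRetract n B : Set ℝ) ≤
      (2 * (n : ℝ) - 1) * Metric.hausdorffDist (A : Set ℝ) (B : Set ℝ) := by
  obtain ⟨f, hmono, himage, hdist⟩ := exists_strictMonoOn_image_eq hB hBn h
  have hh := Metric.hausdorffDist_nonneg (s := (A : Set ℝ)) (t := (B : Set ℝ))
  set η := Metric.hausdorffDist (A : Set ℝ) (B : Set ℝ)
  have hn' : (2 : ℝ) ≤ n := by exact_mod_cast hn
  have hmem : ∀ {a : ℝ}, a ∈ A → f a ∈ B := fun ha => himage ▸ Finset.mem_image_of_mem f ha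
  have hcard : A.card = n := by
    by_contra hne
    rw [minSep_of_card_ne hne] at h
    linarith
  have hcardB : B.card = n := by
    rw [← himage, Finset.card_image_of_injOn hmono.injOn, hcard]
  have hsep : |minSep n A - minSep n B| ≤ 2 * η := by
    rw [abs_le]
    constructor
    · obtain ⟨a, ha, b, hb, hab, hd⟩ := exists_dist_eq_minSep hn hcard
      have hlt := hmono ha hb hab
      have hle := minSep_le_dist n (hmem hb) (hmem ha) hlt.ne'
      rw [Real.dist_eq, abs_of_pos (sub_pos.2 hlt)] at hle
      linarith [(abs_le.1 (hdist a ha)).2, (abs_le.1 (hdist b hb)).1]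
    · obtain ⟨a', ha', b', hb', hab, hd⟩ := exists_dist_eq_minSep hn hcardB
      rw [← himage] at ha' hb'
      obtain ⟨a, ha, rfl⟩ := Finset.mem_image.1 ha'
      obtain ⟨b, hb, rfl⟩ := Finset.mem_image.1 hb'
      have hlt := (hmono.lt_iff_lt ha hb).1 hab
      have hle := minSep_le_dist n hb ha hlt.ne'
      rw [Real.dist_eq, abs_of_pos (sub_pos.2 hlt)] at hle
      linarith [(abs_le.1 (hdist a ha)).1, (abs_le.1 (hdist b hb)).2]
  have hpoint : ∀ a ∈ A, dist (a - minSep n A * (countBelow A a : ℝ))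
      (f a - minSep n B * (countBelow B (f a) : ℝ)) ≤ (2 * (n : ℝ) - 1) * η := fun a ha => by
    have hc : countBelow B (f a) = countBelow A a := by
      rw [← himage, countBelow_image_of_strictMonoOn hmono ha]
    rw [hc]
    calc dist (a - minSep n A * (countBelow A a : ℝ)) (f a - minSep n B * (countBelow A a : ℝ))
        ≤ dist a (f a) + dist (minSep n A * (countBelow A a : ℝ))
            (minSep n B * (countBelow A a : ℝ)) := dist_sub_sub_le _ _ _ _
      _ = dist a (f a) + |minSep n A - minSep n B| * (countBelow A a : ℝ) := by
          rw [Real.dist_eq (_ * _), ← sub_mul, abs_mul, Nat.abs_cast]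
      _ ≤ η + 2 * η * ((n : ℝ) - 1) := by
          gcongr
          · exact hdist a ha
          · exact countBelow_le_sub_one hAn ha
      _ = (2 * (n : ℝ) - 1) * η := by ring
  refine Metric.hausdorffDist_le_of_mem_dist (mul_nonneg (by linarith) hh) ?_ ?_
  · intro y hy
    obtain ⟨a, ha, rfl⟩ := Finset.mem_image.1 hy
    exact ⟨_, Finset.mem_image_of_mem _ (hmem ha), hpoint a ha⟩
  · intro y hy
    obtain ⟨b, hb, rfl⟩ := Finset.mem_image.1 hy
    rw [← himage] at hb
    obtain ⟨a, ha, rfl⟩ := Finset.mem_image.1 hb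
    refine ⟨_, Finset.mem_image_of_mem _ ha, ?_⟩
    rw [dist_comm]
    exact hpoint a ha

theorem hausdorffDist_lineRetract_le {n : ℕ} (hn : 2 ≤ n) {A B : Finset ℝ}
    (hA : A.Nonempty) (hAn : A.card ≤ n) (hB : B.Nonempty) (hBn : B.card ≤ n) :
    Metric.hausdorffDist (lineRetract n A : Set ℝ) (lineRetract n B : Set ℝ) ≤
      (4 * (n : ℝ) - 3) * Metric.hausdorffDist (A : Set ℝ) (B : Set ℝ) := by
  have hn' : (2 : ℝ) ≤ n := by exact_mod_cast hn
  have hh := Metric.hausdorffDist_nonneg (s := (A : Set ℝ)) (t := (B : Set ℝ))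
  have hcoef : (2 * (n : ℝ) - 1) * Metric.hausdorffDist (A : Set ℝ) (B : Set ℝ) ≤
      (4 * (n : ℝ) - 3) * Metric.hausdorffDist (A : Set ℝ) (B : Set ℝ) :=
    mul_le_mul_of_nonneg_right (by linarith) hh
  rcases lt_or_ge (2 * Metric.hausdorffDist (A : Set ℝ) (B : Set ℝ)) (minSep n A) with h₁ | h₁
  · exact (hausdorffDist_lineRetract_le_of_lt_minSep hn hB hAn hBn h₁).trans hcoef
  rcases lt_or_ge (2 * Metric.hausdorffDist (A : Set ℝ) (B : Set ℝ)) (minSep n B) with h₂ | h₂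
  · rw [Metric.hausdorffDist_comm (s := (A : Set ℝ))] at h₂ hcoef ⊢
    rw [Metric.hausdorffDist_comm (s := (lineRetract n A : Set ℝ))]
    exact (hausdorffDist_lineRetract_le_of_lt_minSep hn hA hBn hAn h₂).trans hcoef
  have hrA : (lineRetract n A).Nonempty := hA.image _
  have t₁ := Metric.hausdorffDist_triangle (u := (lineRetract n B : Set ℝ))
    (hausdorffEDist_finset_ne_top hrA hA)
  have t₂ := Metric.hausdorffDist_triangle (u := (lineRetract n B : Set ℝ))
    (hausdorffEDist_finset_ne_top hA hB)
  have dA := hausdorffDist_lineRetract_self_le hn hAn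
  have dB := hausdorffDist_lineRetract_self_le hn hBn
  rw [Metric.hausdorffDist_comm] at dB
  have m₁ := mul_le_mul_of_nonneg_left h₁ (by linarith : (0 : ℝ) ≤ n - 1)
  have m₂ := mul_le_mul_of_nonneg_left h₂ (by linarith : (0 : ℝ) ≤ n - 1)
  linarith

/-- Proposition 4.2: `lineRetract n` is a `(4n-3)`-Lipschitz retraction of `ℝ(n)` onto
`ℝ(n-1)`, with displacement bound `Δ(r(A), A) ≤ (n-1) δ_n(A)`. -/
theorem lineRetract_is_lipschitz_retraction (n : ℕ) (hn : 2 ≤ n) :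
    (∀ A : Finset ℝ, A.Nonempty → A.card ≤ n →
      (lineRetract n A).Nonempty ∧ (lineRetract n A).card ≤ n - 1) ∧
    (∀ A : Finset ℝ, A.Nonempty → A.card ≤ n - 1 → lineRetract n A = A) ∧
    (∀ A B : Finset ℝ, A.Nonempty → A.card ≤ n → B.Nonempty → B.card ≤ n →
      Metric.hausdorffDist ((lineRetract n A : Finset ℝ) : Set ℝ)
          ((lineRetract n B : Finset ℝ) : Set ℝ) ≤
        (4 * (n : ℝ) - 3) * Metric.hausdorffDist (A : Set ℝ) (B : Set ℝ)) ∧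
    (∀ A : Finset ℝ, A.Nonempty → A.card ≤ n →
      Metric.hausdorffDist ((lineRetract n A : Finset ℝ) : Set ℝ) (A : Set ℝ) ≤
        ((n : ℝ) - 1) * minSep n A) := by
  refine ⟨fun A hA hAn => ⟨hA.image _, ?_⟩, fun A _ hAn => lineRetract_of_card_lt (by omega),
    fun A B hA hAn hB hBn => hausdorffDist_lineRetract_le hn hA hAn hB hBn,
    fun A _ hAn => hausdorffDist_lineRetract_self_le hn hAn⟩
  have := card_lineRetract_lt hn hAn
  omega
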